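/- For all integers r ≥ 2 and n ≥ 1, NGΣ↓_tw(r;n) ≥ rn − r/2 − √((r² − r)n² − (r² − r)n + r²/4). -/

import Mathlib

open scoped Classical

namespace NG

/-- The set of earlier neighbors (back-neighborhood) of vertex `j` in `H`,
with respect to the natural order on `Fin N`. -/
noncomputable def backNbhd {N : ℕ} (H : SimpleGraph (Fin N)) (j : Fin N) :
    Finset (Fin N) :=
  Finset.univ.filter (fun i => (i : ℕ) < (j : ℕ) ∧ H.Adj i j)

/-- The degree of `u` in the subgraph of `H` induced on the first `j` vertices
(the "stage `j`" graph of the construction). -/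
noncomputable def stageDeg {N : ℕ} (H : SimpleGraph (Fin N)) (j : ℕ) (u : Fin N) : ℕ :=
  (Finset.univ.filter (fun w : Fin N => (w : ℕ) < j ∧ (u : ℕ) < j ∧ H.Adj u w)).card

/-- `H` on `Fin N` is a `k`-tree, built in the natural vertex order: the first
`k+1` vertices form a clique, and every later vertex is joined exactly to the
vertices of an existing `k`-clique. -/
def IsKTreeOrd (k : ℕ) (N : ℕ) (H : SimpleGraph (Fin N)) : Prop :=
  1 ≤ k ∧ k + 1 ≤ N ∧
  (∀ i j : Fin N, (i : ℕ) < (j : ℕ) → (j : ℕ) ≤ k → H.Adj i j) ∧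
  (∀ j : Fin N, k < (j : ℕ) →
    (backNbhd H j).card = k ∧ H.IsClique (backNbhd H j : Set (Fin N)))

/-- A linear `k`-tree: a `k`-tree in which each new vertex (after the first added
one) is joined to a `k`-clique containing the vertex added at the previous step. -/
def IsLinearKTreeOrd (k : ℕ) (N : ℕ) (H : SimpleGraph (Fin N)) : Prop :=
  IsKTreeOrd k N H ∧
  ∀ i j : Fin N, (i : ℕ) + 1 = (j : ℕ) → k + 1 < (j : ℕ) → i ∈ backNbhd H j

/-- A `k`-caterpillar: a `k`-tree in which each new vertex (after the first added
one) is joined to a `k`-clique contained in the maximal `(k+1)`-clique created at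
the previous stage. -/
def IsCaterpillarOrd (k : ℕ) (N : ℕ) (H : SimpleGraph (Fin N)) : Prop :=
  IsKTreeOrd k N H ∧
  ∀ i j : Fin N, (i : ℕ) + 1 = (j : ℕ) → k + 1 < (j : ℕ) →
    backNbhd H j ⊆ insert i (backNbhd H i)

/-- A two-sided `k`-tree: a `k`-tree in which each new vertex is joined to a
`k`-clique that either contains a vertex of degree `k` (at that stage) or equals
the `k`-clique to which some previously added vertex was joined. -/
def IsTwoSidedKTreeOrd (k : ℕ) (N : ℕ) (H : SimpleGraph (Fin N)) : Prop :=
  IsKTreeOrd k N H ∧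
  ∀ j : Fin N, k < (j : ℕ) →
    ((∃ u ∈ backNbhd H j, stageDeg H (j : ℕ) u = k) ∨
     (∃ i : Fin N, k < (i : ℕ) ∧ (i : ℕ) < (j : ℕ) ∧ backNbhd H i = backNbhd H j))

/-- The least `k` such that `G` embeds as a subgraph into some graph in the
class `P k`; an edgeless graph gets the value `0`. -/
noncomputable def widthParam (P : ℕ → (N : ℕ) → SimpleGraph (Fin N) → Prop)
    (n : ℕ) (G : SimpleGraph (Fin n)) : ℕ :=
  if G = ⊥ then 0
  else sInf {k | ∃ (N : ℕ) (H : SimpleGraph (Fin N)) (f : Fin n ↪ Fin N),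
    P k N H ∧ ∀ u v : Fin n, G.Adj u v → H.Adj (f u) (f v)}

/-- Tree-width: the least `k` such that `G` is a subgraph of a `k`-tree. -/
noncomputable def treewidth (n : ℕ) (G : SimpleGraph (Fin n)) : ℕ :=
  widthParam IsKTreeOrd n G

/-- Largeur d'arborescence: the least `k` such that `G` is a subgraph of a
two-sided `k`-tree. -/
noncomputable def la (n : ℕ) (G : SimpleGraph (Fin n)) : ℕ :=
  widthParam IsTwoSidedKTreeOrd n G

/-- Path-width: the least `k` such that `G` is a subgraph of a `k`-caterpillar. -/
noncomputable def pw (n : ℕ) (G : SimpleGraph (Fin n)) : ℕ :=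
  widthParam IsCaterpillarOrd n G

/-- Proper path-width: the least `k` such that `G` is a subgraph of a linear
`k`-tree. -/
noncomputable def ppw (n : ℕ) (G : SimpleGraph (Fin n)) : ℕ :=
  widthParam IsLinearKTreeOrd n G

/-- `G` has a complete-graph minor on `m` branch sets: there are `m` pairwise
disjoint nonempty connected vertex sets with an edge between every two of them. -/
def HasCliqueMinor {n : ℕ} (G : SimpleGraph (Fin n)) (m : ℕ) : Prop :=
  ∃ B : Fin m → Finset (Fin n),
    (∀ p, (B p).Nonempty) ∧
    (∀ p, (G.induce ((B p : Finset (Fin n)) : Set (Fin n))).Connected) ∧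
    (∀ p q, p ≠ q → Disjoint (B p) (B q)) ∧
    (∀ p q, p ≠ q → ∃ u ∈ B p, ∃ v ∈ B q, G.Adj u v)

/-- The Hadwiger number: the largest `m` such that `K_m` is a minor of `G`. -/
noncomputable def hadwiger (n : ℕ) (G : SimpleGraph (Fin n)) : ℕ :=
  sSup {m | HasCliqueMinor G m}

/-- `A` is a symmetric matrix whose off-diagonal nonzero pattern is the
adjacency of `G`. -/
def DescribesGraph {n : ℕ} (A : Matrix (Fin n) (Fin n) ℝ)
    (G : SimpleGraph (Fin n)) : Prop :=
  A.IsSymm ∧ ∀ i j : Fin n, i ≠ j → (A i j ≠ 0 ↔ G.Adj i j)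

/-- The Strong Arnold Property: the only symmetric `X` with `AX = O`,
`A∘X = O` and `I∘X = O` is `X = O`. -/
def StrongArnold {n : ℕ} (A : Matrix (Fin n) (Fin n) ℝ) : Prop :=
  ∀ X : Matrix (Fin n) (Fin n) ℝ, X.IsSymm → A * X = 0 →
    (∀ i j, A i j * X i j = 0) → (∀ i, X i i = 0) → X = 0

/-- The nullity of a square real matrix. -/
noncomputable def nullity {n : ℕ} (A : Matrix (Fin n) (Fin n) ℝ) : ℕ :=
  Module.finrank ℝ (LinearMap.ker (Matrix.toLin' A))

/-- The Colin de Verdière type parameter `ξ`: maximum nullity of a matrix in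
`S(G)` with the Strong Arnold Property. -/
noncomputable def xiParam (n : ℕ) (G : SimpleGraph (Fin n)) : ℕ :=
  sSup {m | ∃ A : Matrix (Fin n) (Fin n) ℝ,
    DescribesGraph A G ∧ StrongArnold A ∧ nullity A = m}

/-- The Colin de Verdière type parameter `ν`: maximum nullity of a positive
semidefinite matrix in `S(G)` with the Strong Arnold Property. -/
noncomputable def nuParam (n : ℕ) (G : SimpleGraph (Fin n)) : ℕ :=
  sSup {m | ∃ A : Matrix (Fin n) (Fin n) ℝ,
    DescribesGraph A G ∧ A.PosSemidef ∧ StrongArnold A ∧ nullity A = m}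

/-- The Colin de Verdière number `μ`: maximum nullity of a generalized
Laplacian in `S(G)` with exactly one negative eigenvalue and the Strong Arnold
Property. -/
noncomputable def muParam (n : ℕ) (G : SimpleGraph (Fin n)) : ℕ :=
  sSup {m | ∃ (A : Matrix (Fin n) (Fin n) ℝ) (hA : A.IsHermitian),
    DescribesGraph A G ∧ StrongArnold A ∧
    (Finset.univ.filter (fun i => hA.eigenvalues i < 0)).card = 1 ∧
    (∀ i j : Fin n, i ≠ j → A i j ≤ 0) ∧ nullity A = m}

/-- An `r`-decomposition of `K_n`: spanning subgraphs with pairwise disjoint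
edge sets whose union is all of `K_n`. -/
def IsDecomp {n r : ℕ} (G : Fin r → SimpleGraph (Fin n)) : Prop :=
  (∀ i j : Fin r, i ≠ j → Disjoint (G i) (G j)) ∧ (⨆ i, G i) = ⊤

/-- A non-degenerate `r`-decomposition: every part has at least one edge. -/
def IsNDDecomp {n r : ℕ} (G : Fin r → SimpleGraph (Fin n)) : Prop :=
  IsDecomp G ∧ ∀ i, G i ≠ ⊥

/-- Nordhaus–Gaddum sum upper bound `NGΣ↑_β(r;n)`. -/
noncomputable def NGsumUp {n : ℕ} (β : SimpleGraph (Fin n) → ℕ) (r : ℕ) : ℕ :=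
  sSup {s | ∃ G : Fin r → SimpleGraph (Fin n), IsDecomp G ∧ ∑ i, β (G i) = s}

/-- Nordhaus–Gaddum sum lower bound `NGΣ↓_β(r;n)`. -/
noncomputable def NGsumLow {n : ℕ} (β : SimpleGraph (Fin n) → ℕ) (r : ℕ) : ℕ :=
  sInf {s | ∃ G : Fin r → SimpleGraph (Fin n), IsDecomp G ∧ ∑ i, β (G i) = s}

/-- Non-degenerate Nordhaus–Gaddum sum lower bound `NGΣ↓ⁿ_β(r;n)`. -/
noncomputable def NGsumLowND {n : ℕ} (β : SimpleGraph (Fin n) → ℕ) (r : ℕ) : ℕ :=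
  sInf {s | ∃ G : Fin r → SimpleGraph (Fin n), IsNDDecomp G ∧ ∑ i, β (G i) = s}

/-- Nordhaus–Gaddum product upper bound `NGΠ↑_β(r;n)`. -/
noncomputable def NGprodUp {n : ℕ} (β : SimpleGraph (Fin n) → ℕ) (r : ℕ) : ℕ :=
  sSup {s | ∃ G : Fin r → SimpleGraph (Fin n), IsDecomp G ∧ ∏ i, β (G i) = s}

/-- Non-degenerate Nordhaus–Gaddum product upper bound `NGΠ↑ⁿ_β(r;n)`. -/
noncomputable def NGprodUpND {n : ℕ} (β : SimpleGraph (Fin n) → ℕ) (r : ℕ) : ℕ :=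
  sSup {s | ∃ G : Fin r → SimpleGraph (Fin n), IsNDDecomp G ∧ ∏ i, β (G i) = s}

/-- Nordhaus–Gaddum product lower bound `NGΠ↓_β(r;n)`. -/
noncomputable def NGprodLow {n : ℕ} (β : SimpleGraph (Fin n) → ℕ) (r : ℕ) : ℕ :=
  sInf {s | ∃ G : Fin r → SimpleGraph (Fin n), IsDecomp G ∧ ∏ i, β (G i) = s}

/-- Non-degenerate Nordhaus–Gaddum product lower bound `NGΠ↓ⁿ_β(r;n)`. -/
noncomputable def NGprodLowND {n : ℕ} (β : SimpleGraph (Fin n) → ℕ) (r : ℕ) : ℕ :=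
  sInf {s | ∃ G : Fin r → SimpleGraph (Fin n), IsNDDecomp G ∧ ∏ i, β (G i) = s}

/-- The triangular root `t(r) = ⌈√(2r + 1/4) − 1/2⌉`. -/
noncomputable def trt (r : ℕ) : ℕ := ⌈Real.sqrt (2 * (r : ℝ) + 1 / 4) - 1 / 2⌉₊

/-- `H` is a path together with isolated vertices: its edges are exactly those
of a path through some list of distinct vertices. -/
def IsPathGraph {n : ℕ} (H : SimpleGraph (Fin n)) : Prop :=
  ∃ (m : ℕ) (f : Fin (m + 1) ↪ Fin n), ∀ u v : Fin n,
    H.Adj u v ↔ ∃ a b : Fin (m + 1), (a : ℕ) + 1 = (b : ℕ) ∧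
      ((u = f a ∧ v = f b) ∨ (u = f b ∧ v = f a))

end NG

namespace NG

lemma back_le {k N : ℕ} {H : SimpleGraph (Fin N)} (h : IsKTreeOrd k N H) (j : Fin N) :
    (backNbhd H j).card ≤ k := by
  by_cases hj : k < (j : ℕ)
  · exact (h.2.2.2 j hj).1.le
  · have : backNbhd H j ⊆ Finset.Iio j := by
      intro i hi
      simp only [backNbhd, Finset.mem_filter] at hi
      simpa using hi.2.1
    have := Finset.card_le_card this
    rw [Fin.card_Iio] at this
    omega

lemma sum_bound {n N k : ℕ} (G : SimpleGraph (Fin n)) (f : Fin n ↪ Fin N)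
    (hk : ∀ v, (Finset.univ.filter (fun u => f u < f v ∧ G.Adj u v)).card ≤ k)
    (S : Finset (Fin n)) :
    ∑ v ∈ S, (S.filter (fun u => f u < f v ∧ G.Adj u v)).card
      ≤ ∑ p ∈ Finset.range S.card, min p k := by
  induction S using Finset.induction_on_max_value f with
  | empty => simp
  | insert a S ha hmax ih =>
    rw [Finset.sum_insert ha, Finset.card_insert_of_notMem ha, Finset.sum_range_succ, add_comm]
    refine add_le_add (le_trans (le_of_eq ?_) ih) (le_min ?_ ?_)
    · refine Finset.sum_congr rfl fun v hv => ?_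
      rw [Finset.filter_insert, if_neg]
      rintro ⟨h, -⟩
      exact absurd (hmax v hv) (not_le.2 h)
    · rw [Finset.filter_insert, if_neg (by simp)]
      exact Finset.card_filter_le _ _
    · exact le_trans (Finset.card_le_card (Finset.filter_subset_filter _ (Finset.subset_univ _))) (hk a)

lemma closed {k n : ℕ} (h : k ≤ n) :
    2 * ∑ p ∈ Finset.range n, min p k + k * (k + 1) = 2 * k * n := by
  induction n, h using Nat.le_induction with
  | base =>
    have : ∑ p ∈ Finset.range k, min p k = ∑ p ∈ Finset.range k, p :=
      Finset.sum_congr rfl fun p hp => min_eq_left (Finset.mem_range.1 hp).le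
    rw [this]
    have := Finset.sum_range_id_mul_two k
    rcases k with _ | k
    · simp
    · simp only [Nat.add_sub_cancel] at this
      nlinarith
  | succ m hm ih =>
    rw [Finset.sum_range_succ, min_eq_right hm]
    nlinarith

lemma pairs_eq {n N : ℕ} (G : SimpleGraph (Fin n)) (f : Fin n ↪ Fin N) :
    ((Finset.univ ×ˢ Finset.univ).filter (fun q : Fin n × Fin n => G.Adj q.1 q.2)).card
      ≤ 2 * ∑ v, (Finset.univ.filter (fun u => f u < f v ∧ G.Adj u v)).card := by
  have h1 : ((Finset.univ ×ˢ Finset.univ).filter (fun q : Fin n × Fin n => G.Adj q.1 q.2)).card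
      = ∑ u, ∑ v, if G.Adj u v then 1 else 0 := by
    rw [Finset.card_filter, Finset.sum_product]
  have h2 : ∑ v, (Finset.univ.filter (fun u => f u < f v ∧ G.Adj u v)).card
      = ∑ v, ∑ u, if f u < f v ∧ G.Adj u v then 1 else 0 := by
    simp only [Finset.card_filter]
  have h3 : ∑ v, ∑ u, (if f u < f v ∧ G.Adj u v then 1 else 0)
      = ∑ v, ∑ u, if f v < f u ∧ G.Adj v u then 1 else 0 := Finset.sum_comm
  rw [h1, two_mul, h2]
  nth_rw 2 [h3]
  simp only [← Finset.sum_add_distrib]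
  refine Finset.sum_le_sum fun u _ => Finset.sum_le_sum fun v _ => ?_
  by_cases h : G.Adj u v
  · have hne : f u ≠ f v := fun e => h.ne (f.injective e)
    rcases lt_or_gt_of_ne hne with h' | h' <;> simp [h, h.symm, h']
  · simp [h]

lemma tw_bound {n : ℕ} (hn : 1 ≤ n) (G : SimpleGraph (Fin n)) :
    ((Finset.univ ×ˢ Finset.univ).filter (fun q : Fin n × Fin n => G.Adj q.1 q.2)).card
      + treewidth n G * (treewidth n G + 1) ≤ 2 * treewidth n G * n := by
  by_cases hG : G = ⊥
  · subst hG
    simp [treewidth, widthParam]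
  · obtain ⟨a, b, hab⟩ := SimpleGraph.ne_bot_iff_exists_adj.1 hG
    have hn2 : 2 ≤ n := by
      have h1 := a.2
      have h2 := b.2
      have : (a : ℕ) ≠ b := fun h => hab.ne (Fin.ext h)
      omega
    have hmem : n - 1 ∈ {k | ∃ (N : ℕ) (H : SimpleGraph (Fin N)) (f : Fin n ↪ Fin N),
        IsKTreeOrd k N H ∧ ∀ u v : Fin n, G.Adj u v → H.Adj (f u) (f v)} := by
      refine ⟨n, ⊤, Function.Embedding.refl _, ⟨by omega, by omega, ?_, ?_⟩, ?_⟩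
      · intro i j hij _
        simp only [SimpleGraph.top_adj]
        rintro rfl
        omega
      · intro j hj
        have := j.2
        omega
      · intro u v h
        exact h.ne
    have hle := Nat.sInf_le hmem
    have hin := Nat.sInf_mem ⟨_, hmem⟩
    have htw : treewidth n G = sInf {k | ∃ (N : ℕ) (H : SimpleGraph (Fin N)) (f : Fin n ↪ Fin N),
        IsKTreeOrd k N H ∧ ∀ u v : Fin n, G.Adj u v → H.Adj (f u) (f v)} := by
      simp only [treewidth, widthParam, if_neg hG]
    rw [← htw] at hle hin
    generalize treewidth n G = k at hle hin
    obtain ⟨N, H, f, hH, hf⟩ := hin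
    have h1 := sum_bound (k := k) G f (by
      intro v
      refine le_trans ?_ (back_le hH (f v))
      refine Finset.card_le_card_of_injOn f ?_ f.injective.injOn
      intro u hu
      simp only [Finset.coe_filter, Finset.mem_univ, true_and, Set.mem_setOf_eq] at hu
      simp only [backNbhd, Finset.coe_filter, Finset.mem_univ, true_and, Set.mem_setOf_eq]
      exact ⟨hu.1, hf _ _ hu.2⟩) Finset.univ
    have h2 := pairs_eq G f
    have h3 := closed (k := k) (n := n) (by omega)
    rw [Finset.card_univ, Fintype.card_fin] at h1
    omega

lemma decomp_bound {n r : ℕ} (G : Fin r → SimpleGraph (Fin n)) (hG : IsDecomp G) :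
    n * n - n ≤ ∑ i, ((Finset.univ ×ˢ Finset.univ).filter
      (fun q : Fin n × Fin n => (G i).Adj q.1 q.2)).card := by
  have h := Finset.card_biUnion_le (s := (Finset.univ : Finset (Fin r)))
    (t := fun i => (Finset.univ ×ˢ Finset.univ).filter
      (fun q : Fin n × Fin n => (G i).Adj q.1 q.2))
  refine le_trans ?_ h
  have h2 := Finset.offDiag_card (Finset.univ : Finset (Fin n))
  rw [Finset.card_univ, Fintype.card_fin] at h2
  rw [← h2]
  refine Finset.card_le_card ?_
  rintro ⟨u, v⟩ huv
  have hne : u ≠ v := by simpa using huv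
  have : (⨆ i, G i).Adj u v := by rw [hG.2]; exact hne
  rw [SimpleGraph.iSup_adj] at this
  simpa using this

end NG

/-- For all `r ≥ 2` and `n ≥ 1`:
`NGΣ↓_tw(r;n) ≥ rn − r/2 − √((r²−r)n² − (r²−r)n + r²/4)`. -/
theorem statement9 (r n : ℕ) (hr : 2 ≤ r) (hn : 1 ≤ n) :
    (r : ℝ) * n - (r : ℝ) / 2 -
      Real.sqrt (((r : ℝ) ^ 2 - r) * n ^ 2 - ((r : ℝ) ^ 2 - r) * n + (r : ℝ) ^ 2 / 4)
      ≤ (NG.NGsumLow (NG.treewidth n) r : ℝ) := by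
  have hne : {s | ∃ G : Fin r → SimpleGraph (Fin n), NG.IsDecomp G ∧
      ∑ i, NG.treewidth n (G i) = s}.Nonempty := by
    refine ⟨_, fun i => if i = ⟨0, by omega⟩ then ⊤ else ⊥, ⟨?_, ?_⟩, rfl⟩
    · intro i j hij
      by_cases hi : i = ⟨0, by omega⟩
      · have hj : j ≠ ⟨0, by omega⟩ := fun h => hij (hi.trans h.symm)
        simp [hj]
      · simp [hi]
    · refine top_le_iff.1 (le_trans ?_ (le_iSup _ (⟨0, by omega⟩ : Fin r)))
      simp
  obtain ⟨G, hG, hs⟩ := Nat.sInf_mem hne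
  change _ = NG.NGsumLow (NG.treewidth n) r at hs
  rw [← hs]
  have h1 := NG.decomp_bound G hG
  have h2 : ∀ i, _ := fun i => NG.tw_bound hn (G i)
  have h3 := Finset.sum_le_sum (fun i (_ : i ∈ Finset.univ) => h2 i)
  rw [Finset.sum_add_distrib] at h3
  have h4 : n * n ≤ n + ∑ i, ((Finset.univ ×ˢ Finset.univ).filter
      (fun q : Fin n × Fin n => (G i).Adj q.1 q.2)).card := by omega
  have h5 : n * n + ∑ i, NG.treewidth n (G i) * (NG.treewidth n (G i) + 1)
      ≤ n + ∑ i, 2 * NG.treewidth n (G i) * n := by omega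
  have h6 : (n : ℝ) * n + ∑ i, (NG.treewidth n (G i) : ℝ) * (NG.treewidth n (G i) + 1)
      ≤ n + ∑ i, 2 * (NG.treewidth n (G i) : ℝ) * n := by exact_mod_cast h5
  have h7 := sq_sum_le_card_mul_sum_sq (s := (Finset.univ : Finset (Fin r)))
    (f := fun i => (NG.treewidth n (G i) : ℝ))
  rw [Finset.card_univ, Fintype.card_fin] at h7
  rw [← Finset.sum_mul, ← Finset.mul_sum] at h6
  simp only [mul_add, mul_one, Finset.sum_add_distrib, ← sq] at h6
  push_cast
  set s : ℝ := ∑ i, (NG.treewidth n (G i) : ℝ)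
  set q : ℝ := ∑ i, (NG.treewidth n (G i) : ℝ) ^ 2
  have hr0 : (0 : ℝ) ≤ r := by positivity
  have h8 := mul_le_mul_of_nonneg_left h6 hr0
  have : (r : ℝ) * n - r / 2 - s ≤ √(((r : ℝ) ^ 2 - r) * n ^ 2 - ((r : ℝ) ^ 2 - r) * n + (r : ℝ) ^ 2 / 4) := by
    apply Real.le_sqrt_of_sq_le
    nlinarith
  linarith
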